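/- Let m, ℓ, r_1, …, r_ℓ be positive integers with 1 ≤ r_1 < r_2 < ⋯ < r_ℓ ≤ m and gcd(r_1, …, r_ℓ, m) = 1. Let A be the set of all positive integers a such that a ≡ r_i (mod m) for some i ∈ {1, …, ℓ}, and let p_A(n) denote the number of partitions of n into parts belonging to A. Then liminf_{n→∞} (log p_A(n)) / (π√(2ℓn/(3m))) ≥ 1. -/

import Mathlib

open Filter Real

/-- The number of partitions of `n` into parts belonging to the set `A`
(with `partCount A 0 = 1`, the empty partition). -/
noncomputable def partCount (A : Set ℕ) (n : ℕ) : ℕ :=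
  Nat.card {p : n.Partition // ∀ i ∈ p.parts, i ∈ A}

theorem partCount_mono {A B : Set ℕ} {n : ℕ} (h : ∀ i ∈ A, i ≤ n → i ∈ B) :
    partCount A n ≤ partCount B n :=
  Nat.card_le_card_of_injective
    (fun p => ⟨p.1, fun i hi => h i (p.2 i hi) (Nat.Partition.le_of_mem_parts hi)⟩)
    (fun _ _ hpq => Subtype.ext (congrArg (fun x => x.1) hpq))

theorem partCount_le_add_of_mem {A : Set ℕ} {a : ℕ} (ha : a ∈ A) (ha0 : 0 < a) (n : ℕ) :
    partCount A n ≤ partCount A (n + a) := by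
  refine Nat.card_le_card_of_injective
    (fun p => ⟨⟨a ::ₘ p.1.parts, ?_, ?_⟩, ?_⟩) (fun p q hpq => ?_)
  · intro i hi
    rcases Multiset.mem_cons.1 hi with rfl | hi
    · exact ha0
    · exact p.1.parts_pos hi
  · rw [Multiset.sum_cons, p.1.parts_sum, add_comm]
  · intro i hi
    rcases Multiset.mem_cons.1 hi with rfl | hi
    · exact ha
    · exact p.2 i hi
  · have := congrArg (fun x => x.1.parts) hpq
    exact Subtype.ext (Nat.Partition.ext ((Multiset.cons_inj_right a).1 this))

theorem partCount_le_add_of_mem_closure {A : Set ℕ} (hA : ∀ a ∈ A, 0 < a) {k : ℕ}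
    (hk : k ∈ AddSubmonoid.closure A) (n : ℕ) : partCount A n ≤ partCount A (n + k) := by
  induction hk using AddSubmonoid.closure_induction generalizing n with
  | mem a ha => exact partCount_le_add_of_mem ha (hA a ha) n
  | zero => exact le_rfl
  | add x y _ _ hx hy => exact (hx n).trans (by rw [← add_assoc]; exact hy (n + x))

theorem exists_partCount_le_add {A : Set ℕ} (hA : ∀ a ∈ A, 0 < a) (hgcd : Nat.setGcd A = 1) :
    ∃ N, ∀ n k, N ≤ k → partCount A n ≤ partCount A (n + k) := by
  obtain ⟨N, hN⟩ := Nat.exists_mem_closure_of_ge A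
  exact ⟨N, fun n k hk => partCount_le_add_of_mem_closure hA (hN k hk (by simp [hgcd])) n⟩

open PowerSeries in
theorem hasSum_coeff_mul {f g : ℝ⟦X⟧} {x a b : ℝ}
    (hf : HasSum (fun n => coeff n f * x ^ n) a) (hg : HasSum (fun n => coeff n g * x ^ n) b) :
    HasSum (fun n => coeff n (f * g) * x ^ n) (a * b) := by
  have e : (fun n => coeff n (f * g) * x ^ n) = fun n =>
      ∑ kl ∈ Finset.HasAntidiagonal.antidiagonal n, (coeff kl.1 f * x ^ kl.1) * (coeff kl.2 g * x ^ kl.2) := by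
    ext n
    rw [coeff_mul, Finset.sum_mul]
    refine Finset.sum_congr rfl fun kl hkl => ?_
    rw [← Finset.HasAntidiagonal.mem_antidiagonal.1 hkl, pow_add]
    ring
  rw [e, ← hf.tsum_eq, ← hg.tsum_eq,
    tsum_mul_tsum_eq_tsum_sum_antidiagonal_of_summable_norm hf.summable.norm hg.summable.norm]
  exact (summable_norm_sum_mul_antidiagonal_of_summable_norm
    hf.summable.norm hg.summable.norm).of_norm.hasSum

open PowerSeries in
theorem hasSum_coeff_one (x : ℝ) : HasSum (fun n => coeff n (1 : ℝ⟦X⟧) * x ^ n) 1 := by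
  have h := hasSum_single (f := fun n => coeff n (1 : ℝ⟦X⟧) * x ^ n) 0
    (fun n hn => by simp [coeff_one, hn])
  simpa using h

open PowerSeries in
theorem hasSum_coeff_prod {ι : Type*} (s : Finset ι) {f : ι → ℝ⟦X⟧} {x : ℝ} {a : ι → ℝ}
    (h : ∀ i ∈ s, HasSum (fun n => coeff n (f i) * x ^ n) (a i)) :
    HasSum (fun n => coeff n (∏ i ∈ s, f i) * x ^ n) (∏ i ∈ s, a i) := by
  classical
  induction s using Finset.induction_on with
  | empty => simpa using hasSum_coeff_one x
  | insert i s hi ih =>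
    rw [Finset.prod_insert hi, Finset.prod_insert hi]
    exact hasSum_coeff_mul (h i (Finset.mem_insert_self i s))
      (ih fun j hj => h j (Finset.mem_insert_of_mem hj))

open PowerSeries PowerSeries.WithPiTopology in
theorem hasSum_coeff_tsum_X_pow {i : ℕ} (hi : 0 < i) {x : ℝ} (hx0 : 0 ≤ x) (hx1 : x < 1) :
    HasSum (fun n => coeff n (∑' j : ℕ, (X : ℝ⟦X⟧) ^ (i * j)) * x ^ n) (1 - x ^ i)⁻¹ := by
  have hS : Summable fun j : ℕ => (X : ℝ⟦X⟧) ^ (i * j) := by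
    simp_rw [pow_mul]
    exact summable_pow_of_constantCoeff_eq_zero (by simp [hi.ne'])
  have hc : ∀ n, HasSum (fun j : ℕ => if n = i * j then (1 : ℝ) else 0)
      (coeff n (∑' j : ℕ, (X : ℝ⟦X⟧) ^ (i * j))) := fun n => by
    have := hS.hasSum.map (coeff (R := ℝ) n) (continuous_coeff ℝ n)
    simpa [Function.comp_def, coeff_X_pow] using this
  have hinj : Function.Injective fun j : ℕ => i * j := fun a b h => Nat.eq_of_mul_eq_mul_left hi h
  rw [← hinj.hasSum_iff]
  · have hg := hasSum_geometric_of_lt_one (pow_nonneg hx0 i) (pow_lt_one₀ hx0 hx1 hi.ne')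
    convert! hg using 2 with j
    have h1 := hasSum_single (f := fun j' : ℕ => if i * j = i * j' then (1 : ℝ) else 0) j
      (fun j' hj' => by
        rw [if_neg]
        exact fun h => hj' (hinj h).symm)
    rw [Function.comp_apply, (hc (i * j)).unique h1]
    simp [pow_mul]
  · intro n hn
    have h0 : (fun j : ℕ => if n = i * j then (1 : ℝ) else 0) = fun _ => 0 := by
      ext j
      rw [if_neg]
      exact fun h => hn ⟨j, h.symm⟩
    have := hc n
    rw [h0] at this
    rw [this.unique hasSum_zero, zero_mul]

open Classical PowerSeries PowerSeries.WithPiTopology in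
theorem hasSum_partCount_inter (A : Set ℕ) (M : ℕ) {x : ℝ} (hx0 : 0 ≤ x) (hx1 : x < 1) :
    HasSum (fun n => (partCount {a | a ∈ A ∧ a ≤ M} n : ℝ) * x ^ n)
      (∏ i ∈ Finset.range M, if i + 1 ∈ A then (1 - x ^ (i + 1))⁻¹ else 1) := by
  have hp := Nat.Partition.hasProd_powerSeriesMk_card_restricted ℝ
    (fun a => a ∈ A ∧ a ≤ M)
  have hq := hasProd_prod_of_ne_finset_one (s := Finset.range M) (L := .unconditional ℕ)
    (f := fun i => if i + 1 ∈ A ∧ i + 1 ≤ M then ∑' j : ℕ, (X : ℝ⟦X⟧) ^ ((i + 1) * j) else 1)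
    (fun i hi => by
      rw [if_neg]
      rintro ⟨-, h⟩
      exact hi (Finset.mem_range.2 (by omega)))
  have e := hp.unique hq
  have hr := hasSum_coeff_prod (Finset.range M) (x := x)
    (f := fun i => if i + 1 ∈ A ∧ i + 1 ≤ M then ∑' j : ℕ, (X : ℝ⟦X⟧) ^ ((i + 1) * j) else 1)
    (a := fun i => if i + 1 ∈ A then (1 - x ^ (i + 1))⁻¹ else 1) (fun i hi => by
      have hi' : i + 1 ≤ M := Finset.mem_range.1 hi
      by_cases h : i + 1 ∈ A
      · simp only [h, hi', and_self, if_true]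
        exact hasSum_coeff_tsum_X_pow (Nat.succ_pos i) hx0 hx1
      · simp only [h, false_and, if_false]
        exact hasSum_coeff_one x)
  rw [← e] at hr
  convert! hr using 3 with n
  rw [coeff_mk, partCount, Nat.card_eq_fintype_card, Fintype.card_subtype]
  rfl

open Classical in
theorem hasSum_partCount_exp {A : Set ℕ} {t S : ℝ} (ht : 0 < t)
    (hS : HasSum (fun i : ℕ => if i + 1 ∈ A then -log (1 - exp (-((i + 1 : ℕ) * t))) else 0) S) :
    HasSum (fun n : ℕ => (partCount A n : ℝ) * exp (-(n * t))) (exp S) := by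
  set x : ℝ := exp (-t) with hx
  have hx0 : 0 ≤ x := (exp_pos _).le
  have hx1 : x < 1 := by rw [hx, exp_lt_one_iff]; linarith
  have hpow : ∀ n : ℕ, exp (-(n * t)) = x ^ n := fun n => by
    rw [hx, ← exp_nat_mul]; congr 1; ring
  simp only [hpow] at hS ⊢
  set G : ℕ → ℝ := fun i => if i + 1 ∈ A then -log (1 - x ^ (i + 1)) else 0 with hG
  have hlt : ∀ i : ℕ, 0 < 1 - x ^ (i + 1) := fun i =>
    sub_pos.2 (pow_lt_one₀ hx0 hx1 (Nat.succ_ne_zero i))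
  have hG0 : ∀ i, 0 ≤ G i := fun i => by
    simp only [hG]
    split_ifs
    · exact neg_nonneg.2 (log_nonpos (hlt i).le (by linarith [pow_nonneg hx0 (i + 1)]))
    · exact le_rfl
  have hfin : ∀ M, HasSum (fun n => (partCount {a | a ∈ A ∧ a ≤ M} n : ℝ) * x ^ n)
      (exp (∑ i ∈ Finset.range M, G i)) := fun M => by
    rw [exp_sum]
    convert! hasSum_partCount_inter A M hx0 hx1 using 2 with i
    simp only [hG]
    split_ifs
    · rw [exp_neg, exp_log (hlt i)]
    · exact exp_zero
  have hnn : ∀ n, 0 ≤ (partCount A n : ℝ) * x ^ n := fun n => by positivity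
  have hbound : ∀ M, ∑ n ∈ Finset.range M, (partCount A n : ℝ) * x ^ n ≤ exp S := fun M => by
    calc _ ≤ ∑ n ∈ Finset.range M, (partCount {a | a ∈ A ∧ a ≤ M} n : ℝ) * x ^ n := by
          refine Finset.sum_le_sum fun n hn => mul_le_mul_of_nonneg_right ?_ (by positivity)
          have hn' := Finset.mem_range.1 hn
          exact Nat.cast_le.2 (partCount_mono fun i hi hin => ⟨hi, by omega⟩)
      _ ≤ exp (∑ i ∈ Finset.range M, G i) :=
          sum_le_hasSum _ (fun n _ => by positivity) (hfin M)
      _ ≤ exp S := exp_le_exp.2 (sum_le_hasSum _ (fun i _ => hG0 i) hS)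
  have hsm := summable_of_sum_range_le hnn hbound
  have hle := Real.tsum_le_of_sum_range_le hnn hbound
  have hge : exp S ≤ ∑' n, (partCount A n : ℝ) * x ^ n := by
    refine le_of_tendsto ((continuous_exp.tendsto S).comp hS.tendsto_sum_nat)
      (Eventually.of_forall fun M => ?_)
    refine hasSum_le (fun n => mul_le_mul_of_nonneg_right ?_ (by positivity)) (hfin M) hsm.hasSum
    exact Nat.cast_le.2 (partCount_mono fun i hi _ => hi.1)
  rw [← le_antisymm hle hge]
  exact hsm.hasSum

theorem mul_exp_div_one_sub_exp_le_one {m r y : ℝ} (hm : 1 ≤ m) (hr : 1 ≤ r) (hy : 0 < y) :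
    y * exp (-(r * y)) / (1 - exp (-(m * y))) ≤ 1 := by
  have h1 : exp (-(m * y)) ≤ exp (-y) := exp_le_exp.2 (by nlinarith)
  have h2 : exp (-(r * y)) ≤ exp (-y) := exp_le_exp.2 (by nlinarith)
  have h3 : exp (-y) < 1 := by rw [exp_lt_one_iff]; linarith
  rw [div_le_one (by linarith)]
  have h4 : (y + 1) * exp (-y) ≤ 1 := by
    rw [exp_neg, ← div_eq_mul_inv, div_le_one (exp_pos _)]
    exact add_one_le_exp y
  nlinarith [exp_pos (-y)]

theorem tendsto_mul_exp_div_one_sub_exp {m r : ℝ} (hm : 0 < m) :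
    Tendsto (fun y : ℝ => y * exp (-(r * y)) / (1 - exp (-(m * y))))
      (nhdsWithin 0 (Set.Ioi 0)) (nhds m⁻¹) := by
  have hd : HasDerivAt (fun y : ℝ => 1 - exp (-(m * y))) m 0 := by
    have h := (((hasDerivAt_id (0 : ℝ)).const_mul m).neg.exp).const_sub 1
    simpa using h
  have hs := (hasDerivAt_iff_tendsto_slope_zero.1 hd).mono_left
    (nhdsWithin_mono 0 (fun y hy => ne_of_gt hy) : nhdsWithin (0 : ℝ) (Set.Ioi 0) ≤ _)
  have he : Tendsto (fun y : ℝ => exp (-(r * y))) (nhdsWithin 0 (Set.Ioi 0)) (nhds 1) := by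
    have : Continuous fun y : ℝ => exp (-(r * y)) := by fun_prop
    have h := this.tendsto 0
    simp only [mul_zero, neg_zero, exp_zero] at h
    exact h.mono_left nhdsWithin_le_nhds
  have h := he.mul (hs.inv₀ hm.ne')
  rw [one_mul] at h
  refine h.congr fun y => ?_
  simp
  ring

/-- The sum `∑ₖ e^{-r(k+1)t} / ((k+1)(1 - e^{-m(k+1)t}))`, which is the logarithm of the generating
function, at `e^{-t}`, of partitions into parts congruent to `r` modulo `m`. -/
noncomputable def logGenFun (m r t : ℝ) : ℝ :=
  ∑' k : ℕ, exp (-(r * ((k + 1) * t))) / ((k + 1) * (1 - exp (-(m * ((k + 1) * t)))))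

theorem summable_inv_succ_sq : Summable fun k : ℕ => ((k : ℝ) + 1)⁻¹ ^ 2 := by
  have := (summable_nat_add_iff 1).2 hasSum_zeta_two.summable
  simpa using this

theorem mul_logGenFun_term {m r t : ℝ} (k : ℕ) :
    t * (exp (-(r * ((k + 1) * t))) / ((k + 1) * (1 - exp (-(m * ((k + 1) * t)))))) =
      ((k : ℝ) + 1)⁻¹ ^ 2 *
        (((k + 1) * t) * exp (-(r * ((k + 1) * t))) / (1 - exp (-(m * ((k + 1) * t))))) := by
  have : (k : ℝ) + 1 ≠ 0 := by positivity
  by_cases h : 1 - exp (-(m * ((k + 1) * t))) = 0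
  · simp [h]
  · field_simp

theorem logGenFun_term_nonneg {m r t : ℝ} (hm : 0 < m) (ht : 0 < t) (k : ℕ) :
    0 ≤ exp (-(r * ((k + 1) * t))) / ((k + 1) * (1 - exp (-(m * ((k + 1) * t))))) := by
  have h : exp (-(m * ((k + 1) * t))) < 1 := by rw [exp_lt_one_iff]; simp; positivity
  have := sub_pos.2 h
  positivity

theorem mul_logGenFun_term_le {m r t : ℝ} (hm : 1 ≤ m) (hr : 1 ≤ r) (ht : 0 < t) (k : ℕ) :
    t * (exp (-(r * ((k + 1) * t))) / ((k + 1) * (1 - exp (-(m * ((k + 1) * t)))))) ≤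
      ((k : ℝ) + 1)⁻¹ ^ 2 := by
  rw [mul_logGenFun_term]
  exact mul_le_of_le_one_right (by positivity)
    (mul_exp_div_one_sub_exp_le_one hm hr (by positivity))

theorem hasSum_logGenFun {m r t : ℝ} (hm : 1 ≤ m) (hr : 1 ≤ r) (ht : 0 < t) :
    HasSum (fun k : ℕ => exp (-(r * ((k + 1) * t))) / ((k + 1) * (1 - exp (-(m * ((k + 1) * t))))))
      (logGenFun m r t) := by
  refine Summable.hasSum ((summable_mul_left_iff ht.ne').1 ?_)
  exact Summable.of_nonneg_of_le
    (fun k => mul_nonneg ht.le (logGenFun_term_nonneg (by linarith) ht k))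
    (fun k => mul_logGenFun_term_le hm hr ht k) summable_inv_succ_sq

theorem tendsto_mul_logGenFun {m r : ℝ} (hm : 1 ≤ m) (hr : 1 ≤ r) :
    Tendsto (fun t => t * logGenFun m r t) (nhdsWithin 0 (Set.Ioi 0))
      (nhds (π ^ 2 / 6 * m⁻¹)) := by
  have hz : HasSum (fun k : ℕ => ((k : ℝ) + 1)⁻¹ ^ 2) (π ^ 2 / 6) := by
    have := (hasSum_nat_add_iff' 1).2 hasSum_zeta_two
    simpa using this
  rw [← (hz.mul_right m⁻¹).tsum_eq]
  simp_rw [logGenFun, ← tsum_mul_left]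
  refine tendsto_tsum_of_dominated_convergence summable_inv_succ_sq (fun k => ?_) ?_
  · simp_rw [mul_logGenFun_term]
    refine Tendsto.const_mul _ ((tendsto_mul_exp_div_one_sub_exp (by linarith)).comp ?_)
    rw [tendsto_nhdsWithin_iff]
    constructor
    · have : Continuous fun t : ℝ => ((k : ℝ) + 1) * t := by fun_prop
      have h := this.tendsto 0
      rw [mul_zero] at h
      exact h.mono_left nhdsWithin_le_nhds
    · filter_upwards [self_mem_nhdsWithin] with t (ht : 0 < t)
      exact mul_pos (by positivity) ht
  · filter_upwards [self_mem_nhdsWithin] with t (ht : 0 < t) k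
    rw [norm_of_nonneg (mul_nonneg ht.le (logGenFun_term_nonneg (by linarith) ht k))]
    exact mul_logGenFun_term_le hm hr ht k

theorem hasSum_neg_log_one_sub_exp {m r t : ℝ} (hm : 1 ≤ m) (hr : 1 ≤ r) (ht : 0 < t) :
    HasSum (fun j : ℕ => -log (1 - exp (-((r + m * j) * t)))) (logGenFun m r t) := by
  have hf : ∀ k : ℕ, HasSum
      (fun j : ℕ => exp (-((r + m * j) * t)) ^ (k + 1) / ((k : ℝ) + 1))
      (exp (-(r * ((k + 1) * t))) / ((k + 1) * (1 - exp (-(m * ((k + 1) * t)))))) := fun k => by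
    have hlt : exp (-(m * ((k + 1) * t))) < 1 := by rw [exp_lt_one_iff]; simp; positivity
    have h := (hasSum_geometric_of_lt_one (exp_pos _).le hlt).mul_left
      (exp (-(r * ((k + 1) * t))) / ((k : ℝ) + 1))
    convert! h using 1
    · ext j
      rw [← exp_nat_mul, ← exp_nat_mul, div_mul_eq_mul_div, ← exp_add]
      congr 2
      push_cast
      ring
    · rw [← div_eq_mul_inv, div_div]
  set F : ℕ × ℕ → ℝ := fun p => exp (-((r + m * p.2) * t)) ^ (p.1 + 1) / ((p.1 : ℝ) + 1) with hF
  have hs : Summable F := by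
    refine (summable_prod_of_nonneg (fun p => ?_)).2 ⟨fun k => (hf k).summable, ?_⟩
    · simp only [hF, Pi.zero_apply]
      positivity
    · exact (hasSum_logGenFun hm hr ht).summable.congr fun k => (hf k).tsum_eq.symm
  have htot : HasSum F (logGenFun m r t) := by
    rw [← (HasSum.prod_fiberwise hs.hasSum hf).unique (hasSum_logGenFun hm hr ht)]
    exact hs.hasSum
  have hswap : HasSum (fun p : ℕ × ℕ => F (p.2, p.1)) (logGenFun m r t) :=
    (Equiv.prodComm ℕ ℕ).hasSum_iff.2 htot
  have hlog : ∀ j : ℕ, HasSum (fun k : ℕ => F (k, j)) (-log (1 - exp (-((r + m * j) * t)))) := by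
    intro j
    have hlt : |exp (-((r + m * j) * t))| < 1 := by
      rw [abs_of_pos (exp_pos _), exp_lt_one_iff]
      have : 0 < (r + m * j) * t := by positivity
      linarith
    simp only [hF]
    exact hasSum_pow_div_log_of_abs_lt_one hlt
  exact hswap.prod_fiberwise hlog

theorem add_mul_sub_one_injective {m ℓ : ℕ} {r : Fin ℓ → ℕ} (hinj : Function.Injective r)
    (hr1 : ∀ i, 1 ≤ r i) (hrm : ∀ i, r i ≤ m) :
    Function.Injective fun p : Fin ℓ × ℕ => r p.1 + m * p.2 - 1 := by
  rintro ⟨i, j⟩ ⟨i', j'⟩ h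
  have h1 := hr1 i
  have h2 := hr1 i'
  have h3 := hrm i
  have h4 := hrm i'
  have h' : (r i - 1) + m * j = (r i' - 1) + m * j' := by
    simp only at h
    omega
  have hm : 0 < m := by omega
  have hd := congrArg (· / m) h'
  simp only [Nat.add_mul_div_left _ _ hm] at hd
  rw [Nat.div_eq_of_lt (by omega), Nat.div_eq_of_lt (by omega)] at hd
  have hj : j = j' := by omega
  subst hj
  have : r i = r i' := by omega
  exact Prod.ext (hinj this) rfl

theorem modEq_iff_exists_add_mul {m a r : ℕ} (ha : 0 < a) (hrm : r ≤ m) :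
    a ≡ r [MOD m] ↔ ∃ j, a = r + m * j := by
  constructor
  · intro h
    have hle : r ≤ a := by
      by_contra hlt
      have hd := (Nat.modEq_iff_dvd' (by omega)).1 h
      have := Nat.le_of_dvd (by omega) hd
      omega
    obtain ⟨j, hj⟩ := (Nat.modEq_iff_dvd' hle).1 h.symm
    exact ⟨j, by omega⟩
  · rintro ⟨j, rfl⟩
    simp [Nat.ModEq]

theorem setGcd_eq_one {m ℓ : ℕ} {r : Fin ℓ → ℕ} (hℓ : 0 < ℓ) (hr1 : ∀ i, 1 ≤ r i)
    (hgcd : Nat.gcd (Finset.univ.gcd r) m = 1) :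
    Nat.setGcd {a : ℕ | 0 < a ∧ ∃ i, a ≡ r i [MOD m]} = 1 := by
  set A : Set ℕ := {a : ℕ | 0 < a ∧ ∃ i, a ≡ r i [MOD m]}
  have h1 : ∀ i, Nat.setGcd A ∣ r i := fun i =>
    Nat.setGcd_dvd_of_mem ⟨hr1 i, i, Nat.ModEq.refl _⟩
  have h2 : Nat.setGcd A ∣ r ⟨0, hℓ⟩ + m :=
    Nat.setGcd_dvd_of_mem ⟨by have := hr1 ⟨0, hℓ⟩; omega, ⟨0, hℓ⟩, by simp [Nat.ModEq]⟩
  have h3 : Nat.setGcd A ∣ m := (Nat.dvd_add_right (h1 _)).1 h2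
  rw [← Nat.dvd_one, ← hgcd]
  exact Nat.dvd_gcd (Finset.dvd_gcd fun i _ => h1 i) h3

open Classical in
theorem hasSum_neg_log_of_modEq {m ℓ : ℕ} (hm : 0 < m) {r : Fin ℓ → ℕ}
    (hinj : Function.Injective r) (hr1 : ∀ i, 1 ≤ r i) (hrm : ∀ i, r i ≤ m) {t : ℝ} (ht : 0 < t) :
    HasSum (fun n : ℕ => if n + 1 ∈ {a : ℕ | 0 < a ∧ ∃ i, a ≡ r i [MOD m]} then
      -log (1 - exp (-((n + 1 : ℕ) * t))) else 0) (∑ i, logGenFun m (r i) t) := by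
  rw [← (add_mul_sub_one_injective hinj hr1 hrm).hasSum_iff]
  · have hcomp : ((fun n : ℕ => if n + 1 ∈ {a : ℕ | 0 < a ∧ ∃ i, a ≡ r i [MOD m]} then
        -log (1 - exp (-((n + 1 : ℕ) * t))) else 0) ∘ fun p : Fin ℓ × ℕ => r p.1 + m * p.2 - 1) =
        fun p : Fin ℓ × ℕ => -log (1 - exp (-(((r p.1 : ℝ) + m * p.2) * t))) := by
      ext p
      have hp : r p.1 + m * p.2 - 1 + 1 = r p.1 + m * p.2 := by have := hr1 p.1; omega
      rw [Function.comp_apply, hp, if_pos ⟨by have := hr1 p.1; omega, p.1, by simp [Nat.ModEq]⟩]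
      push_cast
      rfl
    rw [hcomp]
    have hfib : ∀ i, HasSum (fun j : ℕ => -log (1 - exp (-(((r i : ℝ) + m * j) * t))))
        (logGenFun m (r i) t) := fun i =>
      hasSum_neg_log_one_sub_exp (by exact_mod_cast hm) (by exact_mod_cast hr1 i) ht
    have hs : Summable fun p : Fin ℓ × ℕ => -log (1 - exp (-(((r p.1 : ℝ) + m * p.2) * t))) := by
      refine (summable_prod_of_nonneg fun p => ?_).2 ⟨fun i => (hfib i).summable, ?_⟩
      · have h1 : (1 : ℝ) ≤ r p.1 := by exact_mod_cast hr1 p.1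
        have h2 : exp (-(((r p.1 : ℝ) + m * p.2) * t)) < 1 := by
          rw [exp_lt_one_iff]
          have : 0 < ((r p.1 : ℝ) + m * p.2) * t := by positivity
          linarith
        have h3 := exp_pos (-(((r p.1 : ℝ) + m * p.2) * t))
        exact neg_nonneg.2 (log_nonpos (by linarith) (by linarith))
      · exact (hasSum_fintype _).summable
    have h := hs.hasSum
    rwa [(h.prod_fiberwise hfib).unique (hasSum_fintype _)] at h
  · intro n hn
    rw [if_neg]
    rintro ⟨h0, i, hi⟩
    obtain ⟨j, hj⟩ := (modEq_iff_exists_add_mul h0 (hrm i)).1 hi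
    exact hn ⟨(i, j), by simp only; omega⟩

theorem tendsto_div_sqrt_of_tendsto_mul {L : ℝ → ℝ} {c : ℝ} (hc : 0 < c)
    (hL : Tendsto (fun t => t * L t) (nhdsWithin 0 (Set.Ioi 0)) (nhds c)) {α : ℝ} (hα : 0 < α) :
    Tendsto (fun n : ℕ => L (α * √(c / n)) / √(c * n)) atTop (nhds α⁻¹) := by
  have ht : Tendsto (fun n : ℕ => α * √(c / n)) atTop (nhdsWithin 0 (Set.Ioi 0)) := by
    rw [tendsto_nhdsWithin_iff]
    constructor
    · have h := ((continuous_sqrt.tendsto 0).comp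
        (tendsto_const_div_atTop_nhds_zero_nat c)).const_mul α
      simpa using h
    · filter_upwards [eventually_gt_atTop 0] with n hn
      have : (0 : ℝ) < n := by exact_mod_cast hn
      exact mul_pos hα (sqrt_pos.2 (div_pos hc this))
  have h := (hL.comp ht).mul_const (α * c)⁻¹
  have e : c * (α * c)⁻¹ = α⁻¹ := by field_simp
  rw [e] at h
  refine h.congr' ?_
  filter_upwards [eventually_gt_atTop 0] with n hn
  have hn' : (0 : ℝ) < n := by exact_mod_cast hn
  have h1 : √(c / n) * √(c * n) = c := by
    rw [← sqrt_mul (by positivity), show c / n * (c * n) = c * c by field_simp, sqrt_mul_self hc.le]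
  have h2 : 0 < √(c * n) := sqrt_pos.2 (by positivity)
  simp only [Function.comp_apply]
  rw [eq_div_iff h2.ne']
  calc _ = α * L (α * √(c / n)) * (α * c)⁻¹ * (√(c / n) * √(c * n)) := by ring
    _ = _ := by rw [h1]; field_simp

/-- Terms with index beyond `n - N` or below `K` are compared with the series at `(1 - δ) * t` and
`(1 + δ) * t` respectively; every remaining coefficient is at most `f n`. -/
theorem exp_le_of_hasSum_of_le_add {f : ℕ → ℝ} {L : ℝ → ℝ} {N : ℕ} (hf : ∀ n, 0 ≤ f n)
    (hsum : ∀ t, 0 < t → HasSum (fun n : ℕ => f n * exp (-(n * t))) (exp (L t)))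
    (hmono : ∀ n k, N ≤ k → f n ≤ f (n + k)) {n : ℕ} {t δ K : ℝ} (ht : 0 < t) (hδ : 0 < δ)
    (hδ1 : δ < 1) :
    exp (L t) ≤ exp (-((n - N) * δ * t) + L ((1 - δ) * t)) + exp (K * δ * t + L ((1 + δ) * t))
      + (n + 1) * (f n * exp (-(K * t))) := by
  have h1 := (hsum ((1 - δ) * t) (by nlinarith)).mul_left (exp (-((n - N) * δ * t)))
  have h2 := (hsum ((1 + δ) * t) (by positivity)).mul_left (exp (K * δ * t))
  have h3 : HasSum (fun k : ℕ => if k ∈ Finset.range (n + 1) then f n * exp (-(K * t)) else 0)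
      ((n + 1) * (f n * exp (-(K * t)))) := by
    have h := hasSum_sum_of_ne_finset_zero (s := Finset.range (n + 1)) (L := .unconditional ℕ)
      (f := fun k : ℕ => if k ∈ Finset.range (n + 1) then f n * exp (-(K * t)) else 0)
      (fun k hk => by simp only [hk, if_false])
    rw [Finset.sum_ite_mem, Finset.inter_self] at h
    simpa using h
  rw [exp_add, exp_add]
  refine hasSum_le (fun k => ?_) (hsum t ht) ((h1.add h2).add h3)
  have p1 : 0 ≤ exp (-((n - N) * δ * t)) * (f k * exp (-(k * ((1 - δ) * t)))) :=
    mul_nonneg (exp_pos _).le (mul_nonneg (hf k) (exp_pos _).le)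
  have p2 : 0 ≤ exp (K * δ * t) * (f k * exp (-(k * ((1 + δ) * t)))) :=
    mul_nonneg (exp_pos _).le (mul_nonneg (hf k) (exp_pos _).le)
  have p3 : 0 ≤ (if k ∈ Finset.range (n + 1) then f n * exp (-(K * t)) else 0) := by
    split_ifs
    · exact mul_nonneg (hf n) (exp_pos _).le
    · exact le_rfl
  have hδt : 0 < δ * t := by positivity
  rcases lt_or_ge n (k + N) with hk | hk
  · have hk' : (n : ℝ) - N ≤ k := by
      have : (n : ℝ) ≤ k + N := by exact_mod_cast hk.le
      linarith
    have : f k * exp (-(k * t)) ≤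
        exp (-((n - N) * δ * t)) * (f k * exp (-(k * ((1 - δ) * t)))) := by
      rw [mul_left_comm, ← exp_add]
      refine mul_le_mul_of_nonneg_left (exp_le_exp.2 ?_) (hf k)
      nlinarith
    linarith
  · rcases lt_or_ge (k : ℝ) K with hK | hK
    · have : f k * exp (-(k * t)) ≤ exp (K * δ * t) * (f k * exp (-(k * ((1 + δ) * t)))) := by
        rw [mul_left_comm, ← exp_add]
        refine mul_le_mul_of_nonneg_left (exp_le_exp.2 ?_) (hf k)
        nlinarith
      linarith
    · have hkn : k ∈ Finset.range (n + 1) := by simp; omega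
      have hfk : f k ≤ f n := by
        have := hmono k (n - k) (by omega)
        rwa [Nat.add_sub_cancel' (by omega)] at this
      have : f k * exp (-(k * t)) ≤ f n * exp (-(K * t)) :=
        mul_le_mul hfk (exp_le_exp.2 (by nlinarith)) (exp_pos _).le (hf n)
      simp only [hkn, if_true] at p3 ⊢
      linarith

theorem tendsto_log_add_one_div_sqrt {c : ℝ} (hc : 0 < c) :
    Tendsto (fun n : ℕ => log (n + 1) / √(c * n)) atTop (nhds 0) := by
  have h := (isLittleO_log_rpow_atTop (r := 1 / 2) (by norm_num)).tendsto_div_nhds_zero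
  have h' := (h.comp (tendsto_natCast_atTop_atTop (R := ℝ))).add
    ((tendsto_const_nhds (x := log 2)).div_atTop
      (((tendsto_rpow_atTop (y := 1 / 2) (by norm_num)).comp
      (tendsto_natCast_atTop_atTop (R := ℝ)))))
  have h'' := h'.mul_const (√c)⁻¹
  simp only [add_zero, zero_mul] at h''
  refine squeeze_zero' ?_ ?_ h''
  · filter_upwards with n
    exact div_nonneg (log_nonneg (by simp)) (sqrt_nonneg _)
  · filter_upwards [eventually_gt_atTop 0] with n hn
    have hn' : (1 : ℝ) ≤ n := by exact_mod_cast hn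
    have h1 : log (n + 1) ≤ log n + log 2 := by
      rw [← log_mul (by positivity) (by positivity)]
      exact log_le_log (by positivity) (by linarith)
    simp only [Function.comp_apply]
    rw [← sqrt_eq_rpow, ← add_div, sqrt_mul hc.le, ← div_eq_mul_inv, div_div, mul_comm (√c)]
    gcongr

/-- A Tauberian lower bound: if `∑ f n e^{-nt} = e^{L t}` with `t * L t → c` as `t → 0⁺` and `f` is
monotone up to bounded shifts, then `log (f n)` is asymptotically at least `2 √(c n)`. -/
theorem eventually_le_log_of_hasSum {f : ℕ → ℝ} {L : ℝ → ℝ} {N : ℕ} {c : ℝ} (hc : 0 < c)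
    (hf : ∀ n, 0 ≤ f n)
    (hsum : ∀ t, 0 < t → HasSum (fun n : ℕ => f n * exp (-(n * t))) (exp (L t)))
    (hL : Tendsto (fun t => t * L t) (nhdsWithin 0 (Set.Ioi 0)) (nhds c))
    (hmono : ∀ n k, N ≤ k → f n ≤ f (n + k)) {δ : ℝ} (hδ : 0 < δ) (hδ1 : δ < 1) :
    ∀ᶠ n : ℕ in atTop, (2 - 3 * δ) * √(c * n) ≤ log (f n) := by
  have hd : 0 < 1 - δ := by linarith
  set s : ℝ := (1 - δ)⁻¹ with hs
  have hs0 : 0 < s := inv_pos.2 hd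
  have hsd : (1 - δ) * s = 1 := mul_inv_cancel₀ hd.ne'
  set T : ℕ → ℝ := fun n => s * √(c / n) with hT
  have hroot : Tendsto (fun n : ℕ => √(c * n)) atTop atTop :=
    tendsto_sqrt_atTop.comp ((tendsto_natCast_atTop_atTop (R := ℝ)).const_mul_atTop hc)
  have l0 : Tendsto (fun n => L (T n) / √(c * n)) atTop (nhds (1 - δ)) := by
    have := tendsto_div_sqrt_of_tendsto_mul hc hL hs0
    rwa [hs, inv_inv] at this
  have l1 : Tendsto (fun n => L ((1 - δ) * T n) / √(c * n)) atTop (nhds 1) := by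
    have := tendsto_div_sqrt_of_tendsto_mul hc hL (α := 1) one_pos
    simpa [hT, ← mul_assoc, hsd] using this
  have l2 : Tendsto (fun n => L ((1 + δ) * T n) / √(c * n)) atTop
      (nhds ((1 - δ) / (1 + δ))) := by
    have := tendsto_div_sqrt_of_tendsto_mul hc hL (α := (1 + δ) * s) (by positivity)
    convert! this using 2
    · simp [hT, ← mul_assoc]
    · rw [hs]; field_simp
  have lN : Tendsto (fun n : ℕ => N * δ * T n / √(c * n)) atTop (nhds 0) := by
    have h := (((continuous_sqrt.tendsto 0).comp
      (tendsto_const_div_atTop_nhds_zero_nat c)).const_mul (N * δ * s))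
    refine (h.div_atTop hroot).congr fun n => ?_
    simp only [hT, Function.comp_apply]
    ring
  have llog := tendsto_log_add_one_div_sqrt hc
  have l2log : Tendsto (fun n : ℕ => log 4 / √(c * n)) atTop (nhds 0) :=
    tendsto_const_nhds.div_atTop hroot
  -- the two tails are each at most a quarter of the total
  have g1 : 0 < (1 - δ) - (1 - δ * s) := by
    have : 1 < s := by rw [hs]; exact (one_lt_inv₀ hd).2 (by linarith)
    nlinarith
  have e1 : ∀ᶠ n : ℕ in atTop, 0 <
      L (T n) / √(c * n) - (L ((1 - δ) * T n) / √(c * n) + N * δ * T n / √(c * n) - δ * s)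
        - log 4 / √(c * n) := by
    have := (l0.sub ((l1.add lN).sub_const (δ * s))).sub l2log
    refine this.eventually (lt_mem_nhds ?_)
    linarith
  have e2 : ∀ᶠ n : ℕ in atTop, 0 <
      L (T n) / √(c * n) - (L ((1 + δ) * T n) / √(c * n) + (1 - δ) ^ 2 * δ)
        - log 4 / √(c * n) := by
    have := (l0.sub (l2.add_const ((1 - δ) ^ 2 * δ))).sub l2log
    refine this.eventually (lt_mem_nhds ?_)
    have : (1 - δ) / (1 + δ) = (1 - δ) - δ * (1 - δ) / (1 + δ) := by field_simp; ring
    have h' : (1 - δ) ^ 2 * δ < δ * (1 - δ) / (1 + δ) := by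
      rw [lt_div_iff₀ (by linarith)]
      nlinarith [mul_pos (mul_pos hδ hd) (mul_pos hδ hδ)]
    linarith
  have e3 : ∀ᶠ n : ℕ in atTop, 2 - 3 * δ <
      L (T n) / √(c * n) + (1 - δ) ^ 2 - log (n + 1) / √(c * n) - log 4 / √(c * n) := by
    have := ((l0.add_const ((1 - δ) ^ 2)).sub llog).sub l2log
    refine this.eventually (lt_mem_nhds ?_)
    nlinarith
  filter_upwards [e1, e2, e3, eventually_gt_atTop 0] with n h1 h2 h3 hn
  have hn' : (0 : ℝ) < n := by exact_mod_cast hn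
  have hq : 0 < √(c * n) := sqrt_pos.2 (by positivity)
  have hTpos : 0 < T n := mul_pos hs0 (sqrt_pos.2 (by positivity))
  have hnT : n * T n = s * √(c * n) := by
    have : √(c * n) = √(c / n) * n := by
      conv_rhs => rw [← sqrt_sq hn'.le]
      rw [← sqrt_mul (by positivity)]
      congr 1
      have := sqrt_sq hn'.le
      rw [this]; field_simp
    rw [this]; simp only [hT]; ring
  have key := exp_le_of_hasSum_of_le_add hf hsum hmono (n := n) (K := (1 - δ) ^ 3 * n)
    hTpos hδ hδ1
  have k1 : exp (-((n - N) * δ * T n) + L ((1 - δ) * T n)) ≤ exp (L (T n)) / 4 := by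
    rw [← exp_log (show (0 : ℝ) < 4 by norm_num), ← exp_sub]
    refine exp_le_exp.2 ?_
    have h := mul_pos h1 hq
    have : (n - N) * δ * T n = δ * s * √(c * n) - N * δ * T n := by linear_combination δ * hnT
    rw [this]
    field_simp at h
    linarith
  have hK : (1 - δ) ^ 3 * n * T n = (1 - δ) ^ 2 * √(c * n) := by
    linear_combination (1 - δ) ^ 3 * hnT + (1 - δ) ^ 2 * √(c * n) * hsd
  have k2 : exp ((1 - δ) ^ 3 * n * δ * T n + L ((1 + δ) * T n)) ≤ exp (L (T n)) / 4 := by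
    rw [← exp_log (show (0 : ℝ) < 4 by norm_num), ← exp_sub]
    refine exp_le_exp.2 ?_
    have h := mul_pos h2 hq
    have : (1 - δ) ^ 3 * n * δ * T n = (1 - δ) ^ 2 * δ * √(c * n) := by
      linear_combination δ * hK
    rw [this]
    field_simp at h
    linarith
  rw [hK] at key
  have k3 : exp (L (T n)) / 4 ≤ (n + 1) * (f n * exp (-((1 - δ) ^ 2 * √(c * n)))) := by
    have := exp_pos (L (T n))
    linarith
  have k4 : exp (L (T n) + (1 - δ) ^ 2 * √(c * n) - log (n + 1) - log 4) ≤ f n := by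
    rw [exp_sub, exp_sub, exp_add, exp_log (by positivity), exp_log (by norm_num)]
    rw [exp_neg] at k3
    have := exp_pos ((1 - δ) ^ 2 * √(c * n))
    field_simp at k3 ⊢
    linarith
  have k5 := log_le_log (exp_pos _) k4
  rw [log_exp] at k5
  have h := mul_lt_mul_of_pos_right h3 hq
  field_simp at h
  linarith

theorem eventually_log_le_of_hasSum {f : ℕ → ℝ} {L : ℝ → ℝ} {c : ℝ} (hc : 0 < c)
    (hf : ∀ n, 0 ≤ f n)
    (hsum : ∀ t, 0 < t → HasSum (fun n : ℕ => f n * exp (-(n * t))) (exp (L t)))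
    (hL : Tendsto (fun t => t * L t) (nhdsWithin 0 (Set.Ioi 0)) (nhds c)) :
    ∀ᶠ n : ℕ in atTop, log (f n) ≤ 3 * √(c * n) := by
  have l1 := tendsto_div_sqrt_of_tendsto_mul hc hL (α := 1) one_pos
  rw [inv_one] at l1
  filter_upwards [l1.eventually (gt_mem_nhds (show (1 : ℝ) < 2 by norm_num)),
    eventually_gt_atTop 0] with n h hn
  have hn' : (0 : ℝ) < n := by exact_mod_cast hn
  have hq : 0 < √(c * n) := sqrt_pos.2 (by positivity)
  rw [div_lt_iff₀ hq, one_mul] at h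
  rcases (hf n).eq_or_lt with h0 | h0
  · rw [← h0, log_zero]; positivity
  have ht : 0 < √(c / n) := sqrt_pos.2 (by positivity)
  have hle := le_hasSum (hsum _ ht) n (fun k _ => mul_nonneg (hf k) (exp_pos _).le)
  have hnt : n * √(c / n) = √(c * n) := by
    rw [← sqrt_sq hn'.le, ← sqrt_mul (by positivity), sqrt_sq hn'.le]
    congr 1
    field_simp
  rw [hnt] at hle
  have := log_le_log (mul_pos h0 (exp_pos _)) hle
  rw [log_exp, log_mul h0.ne' (exp_pos _).ne', log_exp] at this
  linarith

theorem stmt_2 (m ℓ : ℕ) (hm : 0 < m) (hℓ : 0 < ℓ) (r : Fin ℓ → ℕ)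
    (hmono : StrictMono r) (hr1 : ∀ i, 1 ≤ r i) (hrm : ∀ i, r i ≤ m)
    (hgcd : Nat.gcd (Finset.univ.gcd r) m = 1)
    (A : Set ℕ) (hA : A = {a : ℕ | 0 < a ∧ ∃ i, a ≡ r i [MOD m]}) :
    1 ≤ Filter.liminf
      (fun n : ℕ =>
        Real.log (partCount A n) / (π * Real.sqrt (2 * ℓ * n / (3 * m))))
      atTop := by
  have hm' : (0 : ℝ) < m := by exact_mod_cast hm
  have hℓ' : (0 : ℝ) < ℓ := by exact_mod_cast hℓ
  set c : ℝ := ℓ * (π ^ 2 / 6 * (m : ℝ)⁻¹) with hcdef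
  have hc : 0 < c := by positivity
  set L : ℝ → ℝ := fun t => ∑ i, logGenFun m (r i) t with hLdef
  have hsum : ∀ t, 0 < t →
      HasSum (fun n : ℕ => (partCount A n : ℝ) * exp (-(n * t))) (exp (L t)) := fun t ht => by
    rw [hA]
    refine hasSum_partCount_exp ht ?_
    convert! hasSum_neg_log_of_modEq hm hmono.injective hr1 hrm ht
  have hL : Tendsto (fun t => t * L t) (nhdsWithin 0 (Set.Ioi 0)) (nhds c) := by
    have h := tendsto_finsetSum (Finset.univ : Finset (Fin ℓ)) fun i _ =>
      tendsto_mul_logGenFun (m := m) (r := r i) (by exact_mod_cast hm) (by exact_mod_cast hr1 i)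
    simpa [hLdef, hcdef, Finset.mul_sum] using h
  obtain ⟨N, hN⟩ := exists_partCount_le_add (A := A) (by rw [hA]; exact fun a ha => ha.1)
    (by rw [hA]; exact setGcd_eq_one hℓ hr1 hgcd)
  have hf : ∀ n, (0 : ℝ) ≤ partCount A n := fun n => Nat.cast_nonneg _
  have hden : ∀ n : ℕ, π * √(2 * ℓ * n / (3 * m)) = 2 * √(c * n) := fun n => by
    conv_lhs => rw [← sqrt_sq pi_pos.le, ← sqrt_mul (by positivity)]
    conv_rhs => rw [← sqrt_sq (show (0 : ℝ) ≤ 2 by norm_num), ← sqrt_mul (by positivity)]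
    congr 1
    rw [hcdef]
    field_simp
    ring
  simp only [hden]
  have hq : ∀ᶠ n : ℕ in atTop, 0 < 2 * √(c * n) := by
    filter_upwards [eventually_gt_atTop 0] with n hn
    have : (0 : ℝ) < n := by exact_mod_cast hn
    positivity
  have hco : IsCoboundedUnder (· ≥ ·) atTop
      (fun n : ℕ => log (partCount A n) / (2 * √(c * n))) := by
    refine IsBoundedUnder.isCoboundedUnder_ge ⟨2, ?_⟩
    rw [eventually_map]
    filter_upwards [eventually_log_le_of_hasSum hc hf hsum hL, hq] with n h h0
    rw [div_le_iff₀ h0]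
    linarith
  refine le_of_forall_lt fun a ha => ?_
  obtain ⟨b, hab, hb⟩ := exists_between (max_lt ha one_half_lt_one)
  refine (max_lt_iff.1 hab).1.trans_le (le_liminf_of_le hco ?_)
  have hb2 := (max_lt_iff.1 hab).2
  filter_upwards [eventually_le_log_of_hasSum (δ := 2 / 3 * (1 - b)) hc hf hsum hL
    (fun n k hk => Nat.cast_le.2 (hN n k hk)) (by linarith) (by linarith), hq] with n h h0
  rw [le_div_iff₀ h0]
  linarith
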